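/- arXiv:1204.5276 — 4 statements merged into one kernel-verified Lean document; each statement's English description precedes it below -/
import Mathlib

section
/- For every positive integer n, the number L_n of Latin squares of order n equals the coefficient of the monomial ∏_{i=1}^n ∏_{j=1}^n X_{ij} in the polynomial per(X)^n, where X = (X_{ij}) is the n×n matrix of indeterminates (a polynomial over ℤ in n² variables). -/
/-- `L` is a Latin square of order `n`: every row and every column is a
bijection of `Fin n` (i.e. contains each symbol exactly once). -/
def IsLatin {n : ℕ} (L : Fin n → Fin n → Fin n) : Prop :=
  (∀ i, Function.Bijective fun j => L i j) ∧ ∀ j, Function.Bijective fun i => L i j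

/-- The permutation determined by a bijective function (junk value `1` otherwise). -/
noncomputable def permOf {n : ℕ} (f : Fin n → Fin n) : Equiv.Perm (Fin n) :=
  if h : Function.Bijective f then Equiv.ofBijective f h else 1

/-- The product of the signs of the rows of `L`. -/
noncomputable def rowSign {n : ℕ} (L : Fin n → Fin n → Fin n) : ℤ :=
  ∏ i, (Equiv.Perm.sign (permOf fun j => L i j) : ℤ)

/-- The product of the signs of the columns of `L`. -/
noncomputable def colSign {n : ℕ} (L : Fin n → Fin n → Fin n) : ℤ :=
  ∏ j, (Equiv.Perm.sign (permOf fun i => L i j) : ℤ)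

/-- The sign of a Latin square: row-sign times column-sign. -/
noncomputable def latinSign {n : ℕ} (L : Fin n → Fin n → Fin n) : ℤ :=
  rowSign L * colSign L

/-- The permutation `α_s` of a Latin square `L`: `α_s i = j` iff `L i j = s`. -/
noncomputable def symPerm {n : ℕ} (L : Fin n → Fin n → Fin n) (s : Fin n) :
    Equiv.Perm (Fin n) :=
  permOf fun i => (permOf fun j => L i j).symm s

/-- The symbol-sign of a Latin square: the product of the signs of the `α_s`. -/
noncomputable def symbolSign {n : ℕ} (L : Fin n → Fin n → Fin n) : ℤ :=
  ∏ s, (Equiv.Perm.sign (symPerm L s) : ℤ)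

/-- The number of Latin squares of order `n`. -/
noncomputable def numLatin (n : ℕ) : ℕ :=
  Nat.card {L : Fin n → Fin n → Fin n // IsLatin L}

/-- The number of even Latin squares of order `n`. -/
noncomputable def numLatinEven (n : ℕ) : ℕ :=
  Nat.card {L : Fin n → Fin n → Fin n // IsLatin L ∧ latinSign L = 1}

/-- The number of odd Latin squares of order `n`. -/
noncomputable def numLatinOdd (n : ℕ) : ℕ :=
  Nat.card {L : Fin n → Fin n → Fin n // IsLatin L ∧ latinSign L = -1}

/-- `L` is normalized: its first row is the identity permutation. -/
def IsNormalized {n : ℕ} (L : Fin n → Fin n → Fin n) : Prop :=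
  ∀ j : Fin n, L ⟨0, j.pos⟩ j = j

/-- `L` is unipotent: all entries on the main diagonal are equal. -/
def IsUnipotent {n : ℕ} (L : Fin n → Fin n → Fin n) : Prop :=
  ∀ i k : Fin n, L i i = L k k

/-- The Alon-Tarsi constant `AT(n) = U_n^E - U_n^O`. -/
noncomputable def AT (n : ℕ) : ℤ :=
  (Nat.card {L : Fin n → Fin n → Fin n //
      IsLatin L ∧ IsNormalized L ∧ IsUnipotent L ∧ latinSign L = 1} : ℤ) -
  (Nat.card {L : Fin n → Fin n → Fin n //
      IsLatin L ∧ IsNormalized L ∧ IsUnipotent L ∧ latinSign L = -1} : ℤ)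

/-- `L` is reduced: first row and first column are the identity. -/
def IsReducedLatin {n : ℕ} (L : Fin n → Fin n → Fin n) : Prop :=
  IsNormalized L ∧ ∀ i : Fin n, L i ⟨0, i.pos⟩ = i

/-- The number of even reduced Latin squares of order `n`. -/
noncomputable def numReducedEven (n : ℕ) : ℕ :=
  Nat.card {L : Fin n → Fin n → Fin n // IsLatin L ∧ IsReducedLatin L ∧ latinSign L = 1}

/-- The number of odd reduced Latin squares of order `n`. -/
noncomputable def numReducedOdd (n : ℕ) : ℕ :=
  Nat.card {L : Fin n → Fin n → Fin n // IsLatin L ∧ IsReducedLatin L ∧ latinSign L = -1}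

/-- `L_n^SE(π)`: Latin squares whose permutation `α₁` (of the first symbol)
is `π` and whose symbol-sign is `+1`. The first symbol is the element of
`Fin n` with value `0`, and `α₁ = π` is expressed by `L i (π i) = first symbol`. -/
noncomputable def numSymEven (n : ℕ) (π : Equiv.Perm (Fin n)) : ℕ :=
  Nat.card {L : Fin n → Fin n → Fin n //
    IsLatin L ∧ (∀ i, (L i (π i)).val = 0) ∧ symbolSign L = 1}

/-- `L_n^SO(π)`: as `numSymEven` but with symbol-sign `-1`. -/
noncomputable def numSymOdd (n : ℕ) (π : Equiv.Perm (Fin n)) : ℕ :=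
  Nat.card {L : Fin n → Fin n → Fin n //
    IsLatin L ∧ (∀ i, (L i (π i)).val = 0) ∧ symbolSign L = -1}

/-- `L_n^CE(π)`: column-even Latin squares with first column `π`. -/
noncomputable def numColEven (n : ℕ) (π : Equiv.Perm (Fin n)) : ℕ :=
  Nat.card {L : Fin n → Fin n → Fin n //
    IsLatin L ∧ (∀ i : Fin n, L i ⟨0, i.pos⟩ = π i) ∧ colSign L = 1}

/-- `L_n^CO(π)`: column-odd Latin squares with first column `π`. -/
noncomputable def numColOdd (n : ℕ) (π : Equiv.Perm (Fin n)) : ℕ :=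
  Nat.card {L : Fin n → Fin n → Fin n //
    IsLatin L ∧ (∀ i : Fin n, L i ⟨0, i.pos⟩ = π i) ∧ colSign L = -1}

/-- `L_n^CE(α, β)`: column-even Latin squares with first row `α` and first column `β`. -/
noncomputable def numColEven₂ (n : ℕ) (α β : Equiv.Perm (Fin n)) : ℕ :=
  Nat.card {L : Fin n → Fin n → Fin n //
    IsLatin L ∧ (∀ j : Fin n, L ⟨0, j.pos⟩ j = α j) ∧
      (∀ i : Fin n, L i ⟨0, i.pos⟩ = β i) ∧ colSign L = 1}

/-- `L_n^CO(α, β)`: column-odd Latin squares with first row `α` and first column `β`. -/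
noncomputable def numColOdd₂ (n : ℕ) (α β : Equiv.Perm (Fin n)) : ℕ :=
  Nat.card {L : Fin n → Fin n → Fin n //
    IsLatin L ∧ (∀ j : Fin n, L ⟨0, j.pos⟩ j = α j) ∧
      (∀ i : Fin n, L i ⟨0, i.pos⟩ = β i) ∧ colSign L = -1}

/-- The `n × n` matrix of indeterminates, over `ℤ`. -/
noncomputable def Xmat (n : ℕ) :
    Matrix (Fin n) (Fin n) (MvPolynomial (Fin n × Fin n) ℤ) :=
  Matrix.of fun i j => MvPolynomial.X (i, j)

/-- The exponent vector of the square-free monomial `∏_{i,j} X i j`. -/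
noncomputable def allOnes (n : ℕ) : (Fin n × Fin n) →₀ ℕ :=
  Finsupp.equivFunOnFinite.symm fun _ => 1

/-- The `(0,1)`-matrix (over `ℤ`) associated to a Boolean matrix. -/
def toInt {n : ℕ} (A : Fin n → Fin n → Bool) : Matrix (Fin n) (Fin n) ℤ :=
  Matrix.of fun i j => if A i j then 1 else 0

/-- `σ₀(A)`: the number of zero entries of a `(0,1)`-matrix. -/
def sigma0 {n : ℕ} (A : Fin n → Fin n → Bool) : ℕ :=
  (Finset.univ.filter fun p : Fin n × Fin n => A p.1 p.2 = false).card

/-- The exponent vector of the product of the monomials `∏ i, X (p s i, i)` over all `s`. -/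
noncomputable def permFamilyExponent {n : ℕ} (p : Fin n → Equiv.Perm (Fin n)) :
    (Fin n × Fin n) →₀ ℕ :=
  ∑ s, ∑ i, Finsupp.single (p s i, i) 1

theorem permFamilyExponent_apply {n : ℕ} (p : Fin n → Equiv.Perm (Fin n)) (a i : Fin n) :
    permFamilyExponent p (a, i) = (Finset.univ.filter fun s => p s i = a).card := by
  simp only [permFamilyExponent, Finsupp.finsetSum_apply, Finsupp.single_apply, Prod.mk.injEq,
    Finset.card_filter]
  refine Finset.sum_congr rfl fun s _ => ?_
  rw [Finset.sum_eq_single i (fun j _ hj => by simp [hj]) (by simp)]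
  simp

theorem permFamilyExponent_eq_allOnes_iff {n : ℕ} (p : Fin n → Equiv.Perm (Fin n)) :
    permFamilyExponent p = allOnes n ↔ ∀ i, Function.Bijective fun s => p s i := by
  simp only [Finsupp.ext_iff, Prod.forall, permFamilyExponent_apply, allOnes,
    Finsupp.equivFunOnFinite_symm_apply_apply, Finset.card_eq_one, Function.bijective_iff_existsUnique,
    Finset.eq_singleton_iff_unique_mem, Finset.mem_filter, Finset.mem_univ, true_and]
  exact forall_comm

theorem permanent_Xmat_pow (n : ℕ) :
    (Xmat n).permanent ^ n =
      ∑ p : Fin n → Equiv.Perm (Fin n), MvPolynomial.monomial (permFamilyExponent p) 1 := by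
  have h : (Xmat n).permanent ^ n = ∏ _s : Fin n, (Xmat n).permanent := by simp
  rw [h]
  simp only [Matrix.permanent, Finset.prod_univ_sum, Fintype.piFinset_univ]
  refine Finset.sum_congr rfl fun p _ => ?_
  simp only [permFamilyExponent, MvPolynomial.monomial_sum_one, Xmat, Matrix.of_apply,
    MvPolynomial.X]

/-- Latin squares correspond to families of row permutations with bijective columns. -/
noncomputable def latinEquivPermFamily (n : ℕ) :
    {L : Fin n → Fin n → Fin n // IsLatin L} ≃
      {p : Fin n → Equiv.Perm (Fin n) // ∀ i, Function.Bijective fun s => p s i} where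
  toFun L := ⟨fun s => Equiv.ofBijective _ (L.2.1 s), L.2.2⟩
  invFun p := ⟨fun s i => p.1 s i, fun s => (p.1 s).bijective, p.2⟩
  left_inv _ := rfl
  right_inv _ := Subtype.ext <| funext fun _ => Equiv.ext fun _ => rfl

/-- **MacMahon.** For every positive integer `n`, the number of Latin squares of
order `n` is the coefficient of `∏_{i,j} X i j` in `per(X)^n`. -/
theorem coeff_permanent_pow_eq_numLatin (n : ℕ) (hn : 0 < n) :
    MvPolynomial.coeff (allOnes n) ((Xmat n).permanent ^ n) = (numLatin n : ℤ) := by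
  classical
  simp only [permanent_Xmat_pow, MvPolynomial.coeff_sum, MvPolynomial.coeff_monomial,
    permFamilyExponent_eq_allOnes_iff]
  rw [numLatin, Nat.card_congr (latinEquivPermFamily n), Nat.card_eq_fintype_card,
    Fintype.card_subtype, Finset.sum_boole]
end

section
/- For every positive integer n, the coefficient of the monomial ∏_{i=1}^n ∏_{j=1}^n X_{ij} in the polynomial det(X)^n, where X = (X_{ij}) is the n×n matrix of indeterminates (a polynomial over ℤ in n² variables), equals (−1)^{n(n−1)/2}·(L_n^EVEN − L_n^ODD). -/
open Equiv Finset MvPolynomial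

theorem permOf_apply {n : ℕ} {f : Fin n → Fin n} (h : Function.Bijective f) (x : Fin n) :
    permOf f x = f x := by
  rw [permOf, dif_pos h, Equiv.ofBijective_apply]

theorem permOf_coe {n : ℕ} (σ : Perm (Fin n)) : permOf (fun x => σ x) = σ :=
  Equiv.ext fun x => permOf_apply σ.bijective x

/-- The sign of an involution is determined by half the size of its support. -/
theorem sign_eq_neg_one_pow_of_sq_eq_one {α : Type*} [Fintype α] [DecidableEq α]
    {σ : Perm α} (h : σ ^ 2 = 1) : Perm.sign σ = (-1) ^ (#σ.support / 2) := by
  have hrep : σ.cycleType = Multiset.replicate (Multiset.card σ.cycleType) 2 :=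
    Multiset.eq_replicate_card.2 fun m hm =>
      le_antisymm
        (Nat.le_of_dvd two_pos ((Perm.dvd_of_mem_cycleType hm).trans (orderOf_dvd_of_pow_eq_one h)))
        (Perm.two_le_of_mem_cycleType hm)
  have hsum : #σ.support = Multiset.card σ.cycleType * 2 := by
    rw [← Perm.sum_cycleType, hrep]
    simp
  rw [Perm.sign_of_cycleType, Perm.sum_cycleType, hsum, Nat.mul_div_cancel _ two_pos, pow_add,
    mul_comm _ 2, pow_mul]
  simp

theorem sign_prodComm (n : ℕ) :
    Perm.sign (Equiv.prodComm (Fin n) (Fin n) : Perm (Fin n × Fin n))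
      = (-1) ^ (n * (n - 1) / 2) := by
  rw [sign_eq_neg_one_pow_of_sq_eq_one (by ext x <;> simp [sq])]
  congr 2
  have : Perm.support (Equiv.prodComm (Fin n) (Fin n) : Perm (Fin n × Fin n))
      = (univ : Finset (Fin n)).offDiag := by
    ext ⟨a, b⟩
    simp [Prod.ext_iff, eq_comm]
  rw [this, offDiag_card]
  simp [Nat.mul_sub]

/-- The conjugate of a Latin square that exchanges the roles of rows and symbols. -/
noncomputable def rowSymbolConj {n : ℕ} (L : Fin n → Fin n → Fin n) : Fin n → Fin n → Fin n :=
  fun s j => (permOf fun i => L i j).symm s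

theorem rowSymbolConj_eq_iff {n : ℕ} {L : Fin n → Fin n → Fin n} (hL : IsLatin L)
    {i j s : Fin n} : rowSymbolConj L s j = i ↔ L i j = s := by
  rw [rowSymbolConj, Equiv.symm_apply_eq, permOf_apply (hL.2 j), eq_comm]

theorem IsLatin.rowSymbolConj {n : ℕ} {L : Fin n → Fin n → Fin n} (hL : IsLatin L) :
    IsLatin (rowSymbolConj L) := by
  refine ⟨fun s => Function.Injective.bijective_of_finite fun j j' h => ?_,
    fun j => (permOf fun i => L i j).symm.bijective⟩
  have h₁ := (rowSymbolConj_eq_iff hL).1 (rfl : _root_.rowSymbolConj L s j = _)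
  have h₂ := (rowSymbolConj_eq_iff hL).1 h.symm
  exact (hL.1 _).1 (h₁.trans h₂.symm)

theorem rowSymbolConj_rowSymbolConj {n : ℕ} {L : Fin n → Fin n → Fin n} (hL : IsLatin L) :
    rowSymbolConj (rowSymbolConj L) = L := by
  ext i j
  rw [(rowSymbolConj_eq_iff hL.rowSymbolConj).2 ((rowSymbolConj_eq_iff hL).2 rfl)]

theorem rowSign_eq_sign {n : ℕ} (L : Fin n → Fin n → Fin n) :
    rowSign L = ((Perm.sign (Equiv.prodCongrRight fun i => permOf fun j => L i j) : ℤˣ) : ℤ) := by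
  simp [rowSign, Equiv.Perm.sign_prodCongrRight]

theorem colSign_eq_sign {n : ℕ} (L : Fin n → Fin n → Fin n) :
    colSign L = (Perm.sign (Equiv.prodCongrLeft fun j => permOf fun i => L i j) : ℤ) := by
  simp [colSign, Equiv.Perm.sign_prodCongrLeft]

theorem latinSign_eq_one_or {n : ℕ} (L : Fin n → Fin n → Fin n) :
    latinSign L = 1 ∨ latinSign L = -1 := by
  rw [latinSign, rowSign_eq_sign, colSign_eq_sign, ← Units.val_mul]
  exact Int.isUnit_iff.1 (Units.isUnit _)

/-- The row, column and symbol signs of a Latin square determine one another. -/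
theorem rowSign_rowSymbolConj {n : ℕ} {L : Fin n → Fin n → Fin n} (hL : IsLatin L) :
    rowSign (rowSymbolConj L) = (-1) ^ (n * (n - 1) / 2) * latinSign L := by
  have key : (Equiv.prodCongrRight fun i => permOf fun j => rowSymbolConj L i j) *
      (Equiv.prodCongrLeft fun j => permOf fun i => L i j) =
      (Equiv.prodComm (Fin n) (Fin n) : Perm (Fin n × Fin n)) *
        Equiv.prodCongrRight fun i => permOf fun j => L i j := by
    ext1 ⟨i, j⟩
    simp [permOf_apply (hL.1 _), permOf_apply (hL.2 _), permOf_apply (hL.rowSymbolConj.1 _),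
      rowSymbolConj_eq_iff hL]
  have hsign := congrArg (fun σ => (Perm.sign σ : ℤ)) key
  simp only [Perm.sign_mul, Units.val_mul, ← rowSign_eq_sign, ← colSign_eq_sign,
    sign_prodComm] at hsign
  have hsq : colSign L * colSign L = 1 := by
    rw [colSign_eq_sign, ← Units.val_mul, Int.units_mul_self, Units.val_one]
  push_cast at hsign
  rw [latinSign, ← mul_assoc, ← hsign, mul_assoc, hsq, mul_one]

open Classical in
theorem sum_latinSign (n : ℕ) :
    ∑ L : Fin n → Fin n → Fin n with IsLatin L, latinSign L
      = (numLatinEven n : ℤ) - numLatinOdd n := by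
  have h (L : Fin n → Fin n → Fin n) : latinSign L =
      (if latinSign L = 1 then 1 else 0) - (if latinSign L = -1 then 1 else 0) := by
    rcases latinSign_eq_one_or L with h | h <;> simp [h]
  rw [sum_congr rfl fun L _ => h L, sum_sub_distrib]
  simp [numLatinEven, numLatinOdd, Nat.card_eq_fintype_card, Fintype.card_subtype, filter_filter]

theorem sum_single_eq_allOnes_iff {n : ℕ} (f : Fin n → Perm (Fin n)) :
    ∑ s, ∑ j, Finsupp.single (f s j, j) 1 = allOnes n ↔ IsLatin fun s j => f s j := by
  have h (i j : Fin n) : (∑ s, ∑ j, Finsupp.single (f s j, j) 1) (i, j) = #{s | f s j = i} := by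
    simp [Finsupp.finsetSum_apply, Finsupp.single_apply, ite_and, and_comm (a := _ = i)]
  simp only [IsLatin, fun s => (f s).bijective, implies_true, true_and,
    Function.bijective_iff_existsUnique, Fintype.existsUnique_iff_card_one]
  rw [DFunLike.ext_iff, Prod.forall, forall_comm]
  simp only [h, allOnes, Finsupp.equivFunOnFinite_symm_apply_apply]

open Classical in
theorem coeff_allOnes_det_pow (n : ℕ) :
    coeff (allOnes n) ((Xmat n).det ^ n)
      = ∑ L : Fin n → Fin n → Fin n with IsLatin L, rowSign L := by
  have hdet : (Xmat n).det = ∑ σ : Perm (Fin n),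
      monomial (∑ j, Finsupp.single (σ j, j) 1) (Perm.sign σ : ℤ) := by
    rw [Matrix.det_apply']
    refine sum_congr rfl fun σ _ => ?_
    rw [monomial_sum_index]
    simp [Xmat, X]
  have hpow : (Xmat n).det ^ n = ∑ f : Fin n → Perm (Fin n),
      monomial (∑ s, ∑ j, Finsupp.single (f s j, j) 1) (∏ s, (Perm.sign (f s) : ℤ)) := by
    have : (Xmat n).det ^ n = ∏ _s : Fin n, (Xmat n).det := by simp
    rw [this, hdet, Fintype.prod_sum]
    simp only [monomial_sum_prod]
  simp only [hpow, coeff_sum, coeff_monomial, sum_single_eq_allOnes_iff, ← sum_filter]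
  refine sum_nbij' (fun f s j => f s j) (fun L s => permOf fun j => L s j) ?_ ?_ ?_ ?_ ?_
  · simp
  · intro L hL
    simp only [mem_filter, mem_univ, true_and] at hL ⊢
    simpa only [permOf_apply (hL.1 _)] using hL
  · intro f _
    simp only [permOf_coe]
  · intro L hL
    simp only [mem_filter, mem_univ, true_and] at hL
    simp only [permOf_apply (hL.1 _)]
  · intro f _
    simp only [rowSign, permOf_coe]

/-- **Stones.** The coefficient of `∏_{i,j} X i j` in `det(X)^n` equals
`(-1)^{n(n-1)/2} (L_n^EVEN - L_n^ODD)`. -/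
theorem coeff_det_pow_eq_latin_diff (n : ℕ) (hn : 0 < n) :
    MvPolynomial.coeff (allOnes n) ((Xmat n).det ^ n)
      = (-1) ^ (n * (n - 1) / 2) * ((numLatinEven n : ℤ) - numLatinOdd n) := by
  classical
  rw [coeff_allOnes_det_pow, ← sum_latinSign, mul_sum]
  symm
  refine sum_nbij' rowSymbolConj rowSymbolConj ?_ ?_ ?_ ?_ ?_ <;> intro L hL <;>
    simp only [mem_filter, mem_univ, true_and] at hL ⊢
  · exact hL.rowSymbolConj
  · exact hL.rowSymbolConj
  · exact rowSymbolConj_rowSymbolConj hL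
  · exact rowSymbolConj_rowSymbolConj hL
  · exact (rowSign_rowSymbolConj hL).symm
end

section
/- Let p be an odd prime, let 0 < k < p, and let A be a p×p (0,1)-matrix that is k-left row shifted, i.e. A_{i,j} = b_{(j + k·i) mod p} for all i,j ∈ {0,…,p−1}, where b = (b_0,…,b_{p−1}) is the first row of A. Then per(A) ≡ |b| (mod p), where |b| is the number of 1's in b. -/
/-- The self-map `σ ↦ (i ↦ σ (i + k) + 1)` of the permutations `σ` of `ZMod p` all of whose
values `i + k * σ i` satisfy `c`. -/
def shiftPerm {p : ℕ} (k : ZMod p) (c : ZMod p → Prop) :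
    Function.End {σ : Equiv.Perm (ZMod p) // ∀ i, c (i + k * σ i)} :=
  fun σ => ⟨(Equiv.addRight k).trans (σ.1.trans (Equiv.addRight 1)), fun i => by
    have h := σ.2 (i + k)
    have e : i + k + k * σ.1 (i + k) = i + k * (σ.1 (i + k) + 1) := by ring
    rw [e] at h
    exact h⟩

lemma shiftPerm_apply {p : ℕ} (k : ZMod p) (c : ZMod p → Prop)
    (σ : {σ : Equiv.Perm (ZMod p) // ∀ i, c (i + k * σ i)}) (i : ZMod p) :
    (shiftPerm k c σ).1 i = σ.1 (i + k) + 1 := rfl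

lemma shiftPerm_pow_apply {p : ℕ} (k : ZMod p) (c : ZMod p → Prop) (n : ℕ)
    (σ : {σ : Equiv.Perm (ZMod p) // ∀ i, c (i + k * σ i)}) (i : ZMod p) :
    ((shiftPerm k c ^ n) σ).1 i = σ.1 (i + n * k) + n := by
  induction n generalizing i with
  | zero =>
    change σ.1 i = _
    simp
  | succ n ih =>
    rw [pow_succ']
    change (shiftPerm k c ((shiftPerm k c ^ n) σ)).1 i = _
    rw [shiftPerm_apply, ih]
    push_cast
    rw [show i + k + n * k = i + (n + 1) * k by ring]
    ring

lemma shiftPerm_pow_eq_one {p : ℕ} (k : ZMod p) (c : ZMod p → Prop) :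
    shiftPerm k c ^ p = 1 := by
  funext σ
  apply Subtype.ext
  ext1 i
  rw [shiftPerm_pow_apply]
  change _ = σ.1 i
  simp

/-- A fixed point of `shiftPerm k c` is a map `i ↦ k⁻¹ * (t - i)` with `c t`. -/
lemma add_mul_eq_of_shiftPerm_eq {p : ℕ} [Fact p.Prime] {k : ZMod p} (hk : k ≠ 0)
    {c : ZMod p → Prop} {σ : {σ : Equiv.Perm (ZMod p) // ∀ i, c (i + k * σ i)}}
    (h : shiftPerm k c σ = σ) (i : ZMod p) : i + k * σ.1 i = k * σ.1 0 := by
  have hn (n : ℕ) : (shiftPerm k c ^ n) σ = σ := by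
    induction n with
    | zero => rfl
    | succ n ih =>
      rw [pow_succ']
      change shiftPerm k c ((shiftPerm k c ^ n) σ) = σ
      rw [ih, h]
  have h0 := shiftPerm_pow_apply k c (i * k⁻¹).val σ 0
  rw [hn, ZMod.natCast_zmod_val, zero_add, inv_mul_cancel_right₀ hk] at h0
  rw [h0]
  field_simp
  ring

lemma card_perm_add_mul_modEq {p : ℕ} [Fact p.Prime] {k : ZMod p} (hk : k ≠ 0)
    (c : ZMod p → Prop) [DecidablePred c] :
    Fintype.card {σ : Equiv.Perm (ZMod p) // ∀ i, c (i + k * σ i)} ≡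
      Fintype.card {t // c t} [MOD p] := by
  have hpow : shiftPerm k c ^ p ^ 1 = 1 := by rw [pow_one, shiftPerm_pow_eq_one]
  refine (Equiv.Perm.card_fixedPoints_modEq hpow).trans ?_
  let _ : DecidablePred (· ∈ Function.fixedPoints (shiftPerm k c)) := fun σ =>
    Function.fixedPoints.decidable (shiftPerm k c) σ
  rw [← Nat.card_eq_fintype_card, ← Nat.card_eq_fintype_card]
  refine congrArg (· % p) (Nat.card_eq_of_bijective
    (fun σ : Function.fixedPoints (shiftPerm k c) =>
      (⟨k * σ.1.1 0, by simpa using σ.1.2 0⟩ : {t // c t})) ⟨?_, ?_⟩)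
  · intro σ τ h
    have h' : k * σ.1.1 0 = k * τ.1.1 0 := congrArg Subtype.val h
    apply Subtype.ext
    apply Subtype.ext
    ext1 i
    have hσ := add_mul_eq_of_shiftPerm_eq hk σ.2 i
    have hτ := add_mul_eq_of_shiftPerm_eq hk τ.2 i
    rw [h', ← hτ] at hσ
    exact mul_left_cancel₀ hk (add_left_cancel hσ)
  · rintro ⟨t, ht⟩
    let π : Equiv.Perm (ZMod p) := (Equiv.subLeft t).trans (Equiv.mulLeft₀ k⁻¹ (inv_ne_zero hk))
    have hπ (i : ZMod p) : π i = k⁻¹ * (t - i) := rfl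
    have hc (i : ZMod p) : c (i + k * π i) := by
      rwa [hπ, mul_inv_cancel_left₀ hk, add_sub_cancel]
    refine ⟨⟨⟨π, hc⟩, ?_⟩, ?_⟩
    · apply Subtype.ext
      ext1 i
      rw [shiftPerm_apply, hπ, hπ]
      field_simp
      ring
    · apply Subtype.ext
      change k * π 0 = t
      rw [hπ, mul_inv_cancel_left₀ hk, sub_zero]

/-- If `p` is an odd prime and `A` is a `p × p` `k`-left row shifted `(0,1)`-matrix
with first row `b`, then `per(A) ≡ |b| (mod p)`. -/
theorem permanent_row_shifted_mod (p : ℕ) (hp : p.Prime) (hodd : Odd p)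
    (k : ℕ) (hk0 : 0 < k) (hkp : k < p)
    (b : Fin p → ℤ) (hb : ∀ j, b j = 0 ∨ b j = 1)
    (A : Matrix (Fin p) (Fin p) ℤ)
    (hA : ∀ i j : Fin p, A i j = b ⟨(j.val + k * i.val) % p, Nat.mod_lt _ hp.pos⟩) :
    A.permanent ≡ ((Finset.univ.filter fun j => b j = 1).card : ℤ) [ZMOD (p : ℤ)] := by
  have : Fact p.Prime := ⟨hp⟩
  have hk : (k : ZMod p) ≠ 0 := by
    rw [Ne, ZMod.natCast_eq_zero_iff]
    exact Nat.not_dvd_of_pos_of_lt hk0 hkp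
  let e : ZMod p ≃ Fin p :=
    { toFun := fun x => ⟨x.val, x.val_lt⟩
      invFun := fun j => (j.val : ZMod p)
      left_inv := fun x => ZMod.natCast_zmod_val x
      right_inv := fun j => Fin.ext (ZMod.val_cast_of_lt j.isLt) }
  have hAe (i j : ZMod p) : A (e i) (e j) = if b (e (j + k * i)) = 1 then 1 else 0 := by
    have he : (⟨((e j).val + k * (e i).val) % p, Nat.mod_lt _ hp.pos⟩ : Fin p) =
        e (j + k * i) := by
      apply Fin.ext
      change (j.val + k * i.val) % p = (j + k * i).val
      simp [ZMod.val_add, ZMod.val_mul, ZMod.val_natCast]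
    rw [hA, he]
    rcases hb (e (j + k * i)) with h | h <;> simp [h]
  have hper : A.permanent = (Fintype.card {σ : Equiv.Perm (ZMod p) //
      ∀ i, b (e (i + k * σ i)) = 1} : ℤ) := by
    rw [Matrix.permanent, Fintype.card_subtype, Finset.card_filter,
      ← Equiv.sum_comp e.permCongr]
    push_cast
    refine Finset.sum_congr rfl fun σ _ => ?_
    rw [← Equiv.prod_comp e]
    simp_rw [Equiv.permCongr_apply, Equiv.symm_apply_apply, hAe, Finset.prod_ite_zero]
    simp
  have hcard : Fintype.card {t : ZMod p // b (e t) = 1} =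
      (Finset.univ.filter fun j => b j = 1).card := by
    rw [← Fintype.card_subtype]
    exact Fintype.card_congr (e.subtypeEquiv fun _ => Iff.rfl)
  rw [hper, ← hcard]
  exact Int.natCast_modEq_iff.2 (card_perm_add_mul_modEq hk fun t => b (e t) = 1)
end

section
/- Let p be an odd prime, let 0 < k < p, and let A be a p×p (0,1)-matrix that is k-left row shifted, i.e. A_{i,j} = b_{(j + k·i) mod p} for all i,j ∈ {0,…,p−1}, where b = (b_0,…,b_{p−1}) is the first row of A. Then there exists e ∈ {1,−1} such that det(A) ≡ e·|b| (mod p), where |b| is the number of 1's in b. -/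
open Matrix in
/-- Powers of a circulant matrix with a single nonzero diagonal. -/
theorem circulant_single_pow {G R : Type*} [AddCommGroup G] [Fintype G] [DecidableEq G]
    [CommSemiring R] (g : G) (a : R) (n : ℕ) :
    circulant (Pi.single g a) ^ n = circulant (Pi.single (n • g) (a ^ n)) := by
  induction n with
  | zero => simp
  | succ n ih =>
    rw [pow_succ, ih, circulant_mul]
    congr 1
    ext i
    simp [circulant_apply, Pi.single_apply, sub_eq_iff_eq_add, succ_nsmul, pow_succ]

open Matrix in
/-- The `p`-th power of a circulant matrix over `ZMod p`, indexed by `ZMod p`, is scalar. -/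
theorem circulant_pow_card {p : ℕ} [Fact p.Prime] (v : ZMod p → ZMod p) :
    circulant v ^ p = circulant (Pi.single 0 (∑ i, v i)) := by
  have sum_single_pow (s : Finset (ZMod p)) :
      circulant (∑ i ∈ s, Pi.single i (v i)) ^ p = circulant (Pi.single 0 (∑ i ∈ s, v i)) := by
    induction s using Finset.induction_on with
    | empty => simp [(Fact.out : p.Prime).ne_zero]
    | insert i s hi ih =>
      have hcomm : Commute (circulant (Pi.single i (v i)))
          (circulant (∑ j ∈ s, Pi.single j (v j))) := circulant_mul_comm _ _
      rw [Finset.sum_insert hi, Finset.sum_insert hi, circulant_add,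
        add_pow_char_of_commute p hcomm, ih, circulant_single_pow, Pi.single_add, circulant_add]
      simp
  simpa [Finset.univ_sum_single] using sum_single_pow Finset.univ

open Matrix in
/-- The determinant of a circulant matrix over `ZMod p` is the sum of its entries in a row. -/
theorem det_circulant_zmod {p : ℕ} [Fact p.Prime] (v : ZMod p → ZMod p) :
    (circulant v).det = ∑ i, v i := by
  rw [← ZMod.pow_card (circulant v).det, ← det_pow, circulant_pow_card, circulant_single,
    scalar_apply, det_diagonal]
  simp

/-- If `p` is an odd prime and `A` is a `p × p` `k`-left row shifted `(0,1)`-matrix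
with first row `b`, then `det(A) ≡ ± |b| (mod p)`. -/
theorem det_row_shifted_mod (p : ℕ) (hp : p.Prime) (hodd : Odd p)
    (k : ℕ) (hk0 : 0 < k) (hkp : k < p)
    (b : Fin p → ℤ) (hb : ∀ j, b j = 0 ∨ b j = 1)
    (A : Matrix (Fin p) (Fin p) ℤ)
    (hA : ∀ i j : Fin p, A i j = b ⟨(j.val + k * i.val) % p, Nat.mod_lt _ hp.pos⟩) :
    ∃ e : ℤ, (e = 1 ∨ e = -1) ∧
      A.det ≡ e * ((Finset.univ.filter fun j => b j = 1).card : ℤ) [ZMOD (p : ℤ)] := by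
  have : Fact p.Prime := ⟨hp⟩
  let e : Fin p ≃ ZMod p :=
    { toFun := fun i => (i.val : ZMod p)
      invFun := fun z => ⟨z.val, z.val_lt⟩
      left_inv := fun i => by simp [ZMod.val_natCast, Nat.mod_eq_of_lt i.isLt]
      right_inv := fun z => by simp }
  let v : ZMod p → ZMod p := fun z => (b (e.symm z) : ZMod p)
  have hk : -(k : ZMod p) ≠ 0 := by
    rw [neg_ne_zero, Ne, ZMod.natCast_eq_zero_iff]
    exact Nat.not_dvd_of_pos_of_lt hk0 hkp
  have hmat : (A.map (Int.cast : ℤ → ZMod p)).transpose =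
      ((Matrix.circulant v).submatrix id (Equiv.mulLeft₀ _ hk)).submatrix e e := by
    ext j i
    have hidx : (⟨(j.val + k * i.val) % p, Nat.mod_lt _ hp.pos⟩ : Fin p) =
        e.symm (e j - -(k : ZMod p) * e i) := by
      rw [Equiv.eq_symm_apply]
      simp [e]
    simp [hA, hidx, Matrix.circulant_apply, v]
  have hsum : ∑ z, v z = ((Finset.univ.filter fun j => b j = 1).card : ZMod p) := by
    rw [← Equiv.sum_comp e v, Finset.card_filter, Nat.cast_sum]
    refine Finset.sum_congr rfl fun j _ => ?_
    rcases hb j with h | h <;> simp [v, h]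
  have hdet : (A.det : ZMod p) = (Equiv.Perm.sign (Equiv.mulLeft₀ _ hk) : ℤ) *
      ((Finset.univ.filter fun j => b j = 1).card : ZMod p) := by
    rw [Int.cast_det, ← Matrix.det_transpose, hmat, Matrix.det_submatrix_equiv_self,
      Matrix.det_permute', det_circulant_zmod, hsum]
  refine ⟨Equiv.Perm.sign (Equiv.mulLeft₀ _ hk), ?_, ?_⟩
  · rcases Int.units_eq_one_or (Equiv.Perm.sign (Equiv.mulLeft₀ _ hk)) with h | h <;> simp [h]
  · rw [← ZMod.intCast_eq_intCast_iff, hdet]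
    push_cast
    rfl
end
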